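/- Let q be a power of a prime and F_q the finite field with q elements. Let A ⊆ F_q \ {0} with |A| ≥ 2 and suppose 0 ∉ A + A. Suppose there is a constant C > 0 such that for every proper subfield G of F_q and all elements c, d ∈ F_q one has |(A + A)^{-1} ∩ (cG + d)| ≤ C·max{|G|^{1/2}, |A + A|^{51/52}}. Then there is a constant c' > 0 depending only on C such that max{|A + A|, |1/A + 1/A|} ≥ c'·min{|A|^{1 + 1/831}, q^{1/761}|A|^{1 - 1/761}}. -/

import Mathlib

open scoped Classical Pointwise

noncomputable section

namespace STP

variable {F : Type} [Field F]

def collinearTriples (A B : Finset F) : ℕ :=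
  (((A ×ˢ A ×ˢ A) ×ˢ (B ×ˢ B ×ˢ B)).filter fun x =>
    (x.1.2.1 - x.1.1) * (x.2.2.2 - x.2.1) = (x.1.2.2 - x.1.1) * (x.2.2.1 - x.2.1)).card

def IsLine (l : Set (F × F)) : Prop :=
  ∃ a b c : F, (a, b) ≠ (0, 0) ∧ l = {p : F × F | a * p.1 + b * p.2 = c}

def incidences (P : Finset (F × F)) (L : Finset (Set (F × F))) : ℕ :=
  ((P ×ˢ L).filter fun x => x.1 ∈ x.2).card

def kIncidences (P : Finset (F × F)) (L : Finset (Set (F × F))) (k : ℕ) : ℕ :=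
  (((Fintype.piFinset fun _ : Fin k => P) ×ˢ L).filter fun x => ∀ i, x.1 i ∈ x.2).card

def numLines (P : Finset (F × F)) : ℕ :=
  Set.ncard {l : Set (F × F) | IsLine l ∧ 2 ≤ (P.filter (· ∈ l)).card}

def addEnergy (X Y : Finset F) : ℕ :=
  (((X ×ˢ X) ×ˢ (Y ×ˢ Y)).filter fun t => t.1.1 + t.2.1 = t.1.2 + t.2.2).card

def mulEnergy (A : Finset F) : ℕ :=
  (((A ×ˢ A) ×ˢ (A ×ˢ A)).filter fun t => t.1.1 * t.2.1 = t.1.2 * t.2.2).card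

def quotSet (X : Finset F) : Set F :=
  {r : F | ∃ x1 ∈ X, ∃ x2 ∈ X, ∃ x3 ∈ X, ∃ x4 ∈ X, x3 ≠ x4 ∧ r = (x1 - x2) / (x3 - x4)}

def subfieldCond (A : Finset F) (C bound : ℝ) : Prop :=
  ∀ G : Subfield F, G ≠ ⊤ → ∀ c d : F,
    ((A.filter fun x => ∃ g ∈ G, x = c * g + d).card : ℝ) ≤
      C * max ((Nat.card G : ℝ) ^ ((1:ℝ)/2)) bound

def linesOf [Fintype F] (P : Finset (F × F)) : Finset (Set (F × F)) :=
  Set.Finite.toFinset (Set.toFinite {l : Set (F × F) | IsLine l ∧ 2 ≤ (P.filter (· ∈ l)).card})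

def tripleCount [Fintype F] (P : Finset (F × F)) : ℕ :=
  ∑ l ∈ linesOf P, ((P.filter (· ∈ l)).card) ^ 3

lemma quad_zero (a b c x y z : F) (hxy : x ≠ y) (hxz : x ≠ z) (hyz : y ≠ z)
    (h1 : a * x ^ 2 + b * x + c = 0) (h2 : a * y ^ 2 + b * y + c = 0)
    (h3 : a * z ^ 2 + b * z + c = 0) : a = 0 ∧ b = 0 ∧ c = 0 := by
  have e1 : a * (x + y) + b = 0 := by
    apply mul_left_cancel₀ (sub_ne_zero.2 hxy); linear_combination h1 - h2
  have e2 : a * (x + z) + b = 0 := by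
    apply mul_left_cancel₀ (sub_ne_zero.2 hxz); linear_combination h1 - h3
  have ha : a = 0 := by
    apply mul_left_cancel₀ (sub_ne_zero.2 hyz); linear_combination e1 - e2
  subst ha
  have hb : b = 0 := by linear_combination e1
  subst hb
  exact ⟨rfl, rfl, by linear_combination h1⟩

/-- the hyperbola attached to a key -/
def hyp (m : F × F × F) (e : F × F) : Prop :=
  (m.1 * e.2 - m.2.1) * (m.1 * e.1⁻¹ - m.2.2) = 1

def key (w : F × F × F × F) : F × F × F :=
  (1 - w.2.1 * w.2.2.1, w.1 * (1 - w.2.1 * w.2.2.1) + w.2.2.1,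
    w.2.2.2 * (1 - w.2.1 * w.2.2.1) + w.2.1)

def word (p : F × F × F × F × F) : F × F × F × F :=
  (p.2.2.2.1 + p.2.2.2.2, p.2.2.1⁻¹ + p.2.2.2.1⁻¹, p.2.1 + p.2.2.1, p.1⁻¹ + p.2.1⁻¹)

lemma hyp_path (a0 a1 a2 a3 a4 : F) (h1 : a1 ≠ 0) (h2 : a2 ≠ 0) (h3 : a3 ≠ 0) :
    hyp (key (word (a0, a1, a2, a3, a4))) (a0, a4) := by
  unfold hyp key word
  simp only
  generalize a0⁻¹ = z
  field_simp
  ring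

lemma hyp_unique (m m' : F × F × F) (hm : m.1 ≠ 0) (hm' : m'.1 ≠ 0) (e1 e2 e3 : F × F)
    (h12 : e1.1 ≠ e2.1) (h13 : e1.1 ≠ e3.1) (h23 : e2.1 ≠ e3.1)
    (a1 : hyp m e1) (a2 : hyp m e2) (a3 : hyp m e3)
    (b1 : hyp m' e1) (b2 : hyp m' e2) (b3 : hyp m' e3) : m' = m ∨ m' = -m := by
  obtain ⟨d, p, g⟩ := m
  obtain ⟨d', p', g'⟩ := m'
  obtain ⟨x1, y1⟩ := e1
  obtain ⟨x2, y2⟩ := e2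
  obtain ⟨x3, y3⟩ := e3
  simp only [hyp] at *
  have i12 : x1⁻¹ ≠ x2⁻¹ := fun h => h12 (inv_injective h)
  have i13 : x1⁻¹ ≠ x3⁻¹ := fun h => h13 (inv_injective h)
  have i23 : x2⁻¹ ≠ x3⁻¹ := fun h => h23 (inv_injective h)
  generalize x1⁻¹ = X1 at *
  generalize x2⁻¹ = X2 at *
  generalize x3⁻¹ = X3 at *
  have key : ∀ X y : F, (d * y - p) * (d * X - g) = 1 → (d' * y - p') * (d' * X - g') = 1 →
      ((p * d' - p' * d) * d * d') * X ^ 2 +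
       (-(p * d' - p' * d) * (d * g' + d' * g) + d' ^ 2 - d ^ 2) * X +
       ((p * d' - p' * d) * g * g' + d * g - d' * g') = 0 := by
    intro X y h h'
    linear_combination (-d' * (d' * X - g')) * h + d * (d * X - g) * h'
  obtain ⟨q1, q2, q3⟩ := quad_zero _ _ _ X1 X2 X3 i12 i13 i23 (key _ _ a1 b1) (key _ _ a2 b2)
    (key _ _ a3 b3)
  have hp : p * d' - p' * d = 0 := by
    simpa [hm, hm'] using q1
  rw [hp] at q2 q3
  have hd : (d' - d) * (d' + d) = 0 := by linear_combination q2
  rcases mul_eq_zero.1 hd with h | h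
  · left
    have hd' : d' = d := by linear_combination h
    subst hd'
    refine Prod.ext rfl (Prod.ext ?_ ?_)
    · apply mul_left_cancel₀ hm; simp only; linear_combination -hp
    · apply mul_left_cancel₀ hm; simp only; linear_combination -q3
  · right
    have hd' : d' = -d := by linear_combination h
    subst hd'
    refine Prod.ext rfl (Prod.ext ?_ ?_)
    · apply mul_left_cancel₀ hm; simp only [Prod.snd_neg, Prod.fst_neg]; linear_combination -hp
    · apply mul_left_cancel₀ hm; simp only [Prod.snd_neg]; linear_combination q3

/-- number of incidences -/
def RS (A : Finset F) (m : F × F × F) : Finset (F × F) := (A ×ˢ A).filter (hyp m)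

lemma RS_inj (A : Finset F) (m : F × F × F) (hm : m.1 ≠ 0) (e e' : F × F) (h : e ∈ RS A m)
    (h' : e' ∈ RS A m) (hne : e ≠ e') : e.1 ≠ e'.1 := by
  intro hx
  apply hne
  refine Prod.ext hx ?_
  simp only [RS, Finset.mem_filter, hyp] at h h'
  have h1 := h.2
  have h2 := h'.2
  rw [← hx] at h2
  have hnz : m.1 * e.1⁻¹ - m.2.2 ≠ 0 := right_ne_zero_of_mul_eq_one h1
  apply mul_left_cancel₀ hm
  apply mul_right_cancel₀ hnz
  linear_combination h1 - h2

def TR (A : Finset F) (m : F × F × F) : Finset ((F × F) × (F × F) × (F × F)) :=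
  (RS A m ×ˢ RS A m ×ˢ RS A m).filter fun x => x.1 ≠ x.2.1 ∧ x.1 ≠ x.2.2 ∧ x.2.1 ≠ x.2.2

lemma triple_lb {α : Type} (R : Finset α) (h6 : 6 ≤ R.card) :
    R.card ^ 3 ≤ 2 * ((R ×ˢ R ×ˢ R).filter
      fun x => x.1 ≠ x.2.1 ∧ x.1 ≠ x.2.2 ∧ x.2.1 ≠ x.2.2).card := by
  set D := (R ×ˢ R ×ˢ R).filter fun x => x.1 ≠ x.2.1 ∧ x.1 ≠ x.2.2 ∧ x.2.1 ≠ x.2.2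
  set B1 := (R ×ˢ R).image (fun y : α × α => (y.1, y.1, y.2))
  set B2 := (R ×ˢ R).image (fun y : α × α => (y.1, y.2, y.1))
  set B3 := (R ×ˢ R).image (fun y : α × α => (y.2, y.1, y.1))
  have hsub : (R ×ˢ R ×ˢ R) ⊆ D ∪ (B1 ∪ (B2 ∪ B3)) := by
    rintro ⟨a, b, c⟩ h
    simp only [Finset.mem_product] at h
    simp only [Finset.mem_union, D, B1, B2, B3, Finset.mem_filter, Finset.mem_product,
      Finset.mem_image, Prod.exists, Prod.mk.injEq]
    by_cases h1 : a = b
    · subst h1; right; left; exact ⟨a, c, ⟨h.1, h.2.2⟩, rfl, rfl, rfl⟩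
    by_cases h2 : a = c
    · subst h2; right; right; left; exact ⟨a, b, ⟨h.1, h.2.1⟩, rfl, rfl, rfl⟩
    by_cases h3 : b = c
    · subst h3; right; right; right; exact ⟨b, a, ⟨h.2.1, h.1⟩, rfl, rfl, rfl⟩
    left; exact ⟨h, h1, h2, h3⟩
  have c0 := Finset.card_le_card hsub
  have c1 : B1.card ≤ R.card * R.card := by
    simpa [Finset.card_product] using Finset.card_image_le (s := R ×ˢ R) (f := (fun y : α × α => (y.1, y.1, y.2)))
  have c2 : B2.card ≤ R.card * R.card := by
    simpa [Finset.card_product] using Finset.card_image_le (s := R ×ˢ R) (f := (fun y : α × α => (y.1, y.2, y.1)))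
  have c3 : B3.card ≤ R.card * R.card := by
    simpa [Finset.card_product] using Finset.card_image_le (s := R ×ˢ R) (f := (fun y : α × α => (y.2, y.1, y.1)))
  have u1 := Finset.card_union_le D (B1 ∪ (B2 ∪ B3))
  have u2 := Finset.card_union_le B1 (B2 ∪ B3)
  have u3 := Finset.card_union_le B2 B3
  simp only [Finset.card_product] at c0
  have hh : 6 * (R.card * R.card) ≤ R.card * (R.card * R.card) := Nat.mul_le_mul_right _ h6
  have : R.card ^ 3 = R.card * (R.card * R.card) := by ring
  omega

lemma sum_TR (A : Finset F) (M : Finset (F × F × F)) (hM : ∀ m ∈ M, m.1 ≠ 0) :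
    ∑ m ∈ M, (TR A m).card ≤ 2 * A.card ^ 6 := by
  set Q := (A ×ˢ A) ×ˢ (A ×ˢ A) ×ˢ (A ×ˢ A)
  have h1 : ∀ m ∈ M, (TR A m).card = (Finset.bipartiteAbove (fun m x => x ∈ TR A m) Q m).card := by
    intro m _
    congr 1
    ext x
    simp only [Finset.mem_bipartiteAbove, TR, RS, Q, Finset.mem_filter, Finset.mem_product]
    tauto
  rw [Finset.sum_congr rfl h1, Finset.sum_card_bipartiteAbove_eq_sum_card_bipartiteBelow]
  have h2 : ∀ x ∈ Q, (Finset.bipartiteBelow (fun m x => x ∈ TR A m) M x).card ≤ 2 := by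
    intro x _
    by_cases hne : (Finset.bipartiteBelow (fun m x => x ∈ TR A m) M x).Nonempty
    · obtain ⟨m, hm⟩ := hne
      have : Finset.bipartiteBelow (fun m x => x ∈ TR A m) M x ⊆ {m, -m} := by
        intro m' hm'
        simp only [Finset.mem_bipartiteBelow] at hm hm'
        have d0 := hM m hm.1
        have d0' := hM m' hm'.1
        have t := hm.2
        have t' := hm'.2
        simp only [TR, Finset.mem_filter, Finset.mem_product] at t t'
        obtain ⟨⟨r1, r2, r3⟩, n1, n2, n3⟩ := t
        obtain ⟨⟨r1', r2', r3'⟩, -, -, -⟩ := t'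
        have k1 := RS_inj A m d0 _ _ r1 r2 n1
        have k2 := RS_inj A m d0 _ _ r1 r3 n2
        have k3 := RS_inj A m d0 _ _ r2 r3 n3
        simp only [RS, Finset.mem_filter] at r1 r2 r3 r1' r2' r3'
        have := hyp_unique m m' d0 d0' _ _ _ k1 k2 k3 r1.2 r2.2 r3.2 r1'.2 r2'.2 r3'.2
        simpa using this
      exact (Finset.card_le_card this).trans Finset.card_le_two
    · rw [Finset.not_nonempty_iff_eq_empty.1 hne]; simp
  calc _ ≤ ∑ x ∈ Q, 2 := Finset.sum_le_sum h2
    _ = 2 * A.card ^ 6 := by simp [Q, Finset.card_product]; ring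

def EQ (S T : Finset F) : Finset ((F × F) × (F × F)) :=
  ((T ×ˢ S) ×ˢ (T ×ˢ S)).filter fun x => x.1.1 * x.1.2 = x.2.1 * x.2.2

lemma pairs_le (S T : Finset F) (Ω : Finset (F × F × F × F))
    (hΩ : ∀ w ∈ Ω, w ∈ S ×ˢ T ×ˢ S ×ˢ T ∧ (key w).1 ≠ 0) :
    ((Ω ×ˢ Ω).filter fun x => key x.1 = key x.2).card ≤ S.card * T.card * (EQ S T).card := by
  rw [← Finset.card_product, ← Finset.card_product]
  apply Finset.card_le_card_of_injOn
    (fun x => ((x.2.1, x.2.2.2.2), ((x.1.2.1, x.1.2.2.1), (x.2.2.1, x.2.2.2.1))))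
  · rintro ⟨⟨s, t, s', t'⟩, ⟨s1, t1, s1', t1'⟩⟩ h
    simp only [Finset.coe_filter, Finset.mem_product, Set.mem_ofPred_eq] at h
    obtain ⟨⟨h1, h2⟩, hk⟩ := h
    have g1 := (hΩ _ h1).1
    have g2 := (hΩ _ h2).1
    simp only [Finset.mem_product] at g1 g2
    simp only [key, Prod.mk.injEq] at hk
    simp only [Finset.coe_product, Set.mem_prod, Finset.mem_coe, EQ, Finset.mem_filter,
      Finset.mem_product]
    refine ⟨⟨g2.1, g2.2.2.2⟩, ⟨⟨g1.2.1, g1.2.2.1⟩, ⟨g2.2.1, g2.2.2.1⟩⟩, ?_⟩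
    linear_combination -hk.1
  · rintro ⟨⟨s, t, s', t'⟩, ⟨s1, t1, s1', t1'⟩⟩ h ⟨⟨r, v, r', v'⟩, ⟨r1, v1, r1', v1'⟩⟩ h' heq
    simp only [Finset.coe_filter, Finset.mem_product, Set.mem_ofPred_eq] at h h'
    have d1 := (hΩ _ h.1.1).2
    have hk := h.2
    have hk' := h'.2
    simp only [key, Prod.mk.injEq, ne_eq] at hk hk' heq d1
    obtain ⟨⟨rfl, rfl⟩, ⟨rfl, rfl⟩, rfl, rfl⟩ := heq
    have es : s = r := by
      apply mul_right_cancel₀ d1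
      linear_combination hk.2.1 - hk'.2.1
    have et : t' = v' := by
      apply mul_right_cancel₀ d1
      linear_combination hk.2.2 - hk'.2.2
    subst es et
    rfl

def PP (A : Finset F) : Finset (F × F × F × F × F) :=
  (A ×ˢ A ×ˢ A ×ˢ A ×ˢ A).filter fun p => (key (word p)).1 ≠ 0

lemma PP_card (A : Finset F) : A.card ^ 5 ≤ (PP A).card + A.card ^ 4 := by
  have h1 : ((A ×ˢ A ×ˢ A ×ˢ A ×ˢ A).filter fun p => ¬ (key (word p)).1 ≠ 0).card ≤ A.card ^ 4 := by
    have : A.card ^ 4 = (A ×ˢ A ×ˢ A ×ˢ A).card := by simp [Finset.card_product]; ring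
    rw [this]
    apply Finset.card_le_card_of_injOn (fun p => (p.1, p.2.2.1, p.2.2.2.1, p.2.2.2.2))
    · rintro ⟨a0, a1, a2, a3, a4⟩ h
      simp only [Finset.coe_filter, Finset.mem_product, Set.mem_ofPred_eq] at h
      simp only [Finset.coe_product, Set.mem_prod, Finset.mem_coe]
      tauto
    · rintro ⟨a0, a1, a2, a3, a4⟩ h ⟨b0, b1, b2, b3, b4⟩ h' heq
      simp only [Finset.coe_filter, Finset.mem_product, Set.mem_ofPred_eq, not_not, key, word] at h h'
      simp only [Prod.mk.injEq] at heq
      obtain ⟨rfl, rfl, rfl, rfl⟩ := heq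
      have e1 : (a2⁻¹ + a3⁻¹) * (a1 + a2) = 1 := by linear_combination -h.2
      have e2 : (a2⁻¹ + a3⁻¹) * (b1 + a2) = 1 := by linear_combination -h'.2
      have hz := left_ne_zero_of_mul_eq_one e1
      have : a1 = b1 := by
        apply mul_left_cancel₀ hz
        linear_combination e1 - e2
      subst this
      rfl
  have h2 := Finset.card_filter_add_card_filter_not (s := A ×ˢ A ×ˢ A ×ˢ A ×ˢ A)
    (fun p => (key (word p)).1 ≠ 0)
  have h3 : A.card ^ 5 = (A ×ˢ A ×ˢ A ×ˢ A ×ˢ A).card := by simp [Finset.card_product]; ring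
  rw [h3, ← h2]
  unfold PP
  omega

lemma fiber_le (A : Finset F) (h0 : (0 : F) ∉ A) (w : F × F × F × F) :
    ((PP A).filter fun p => word p = w).card ≤ (RS A (key w)).card := by
  apply Finset.card_le_card_of_injOn (fun p => (p.1, p.2.2.2.2))
  · rintro ⟨a0, a1, a2, a3, a4⟩ h
    simp only [PP, Finset.coe_filter, Finset.mem_filter, Finset.mem_product, Set.mem_ofPred_eq] at h
    obtain ⟨⟨⟨m0, m1, m2, m3, m4⟩, -⟩, rfl⟩ := h
    simp only [RS, Finset.coe_filter, Finset.mem_product, Set.mem_ofPred_eq]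
    refine ⟨⟨m0, m4⟩, hyp_path _ _ _ _ _ ?_ ?_ ?_⟩
    · rintro rfl; exact h0 m1
    · rintro rfl; exact h0 m2
    · rintro rfl; exact h0 m3
  · rintro ⟨a0, a1, a2, a3, a4⟩ h ⟨b0, b1, b2, b3, b4⟩ h' heq
    simp only [PP, Finset.coe_filter, Finset.mem_filter, Finset.mem_product, Set.mem_ofPred_eq] at h h'
    have hw := h.2.trans h'.2.symm
    simp only [word, Prod.mk.injEq] at hw heq
    obtain ⟨rfl, rfl⟩ := heq
    obtain ⟨w1, w2, w3, w4⟩ := hw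
    have e1 : a1 = b1 := inv_injective (by linear_combination w4)
    subst e1
    have e2 : a2 = b2 := by linear_combination w3
    subst e2
    have e3 : a3 = b3 := by linear_combination w1
    subst e3
    rfl

lemma energy_arith (n K ρ E w r wr : ℝ) (hn0 : 0 < n) (hK0 : 0 < K) (hρ0 : 0 ≤ ρ)
    (hρ' : ρ * (4 * K ^ 4) = n) (hE0 : 0 ≤ E) (hr : 0 ≤ r) (h1 : n ^ 5 / 4 ≤ wr)
    (h2 : ρ * r ≤ 4 * n ^ 6) (h3 : w ≤ (K * n) * (K * n) * E) (h4 : wr ^ 2 ≤ w * r) :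
    n ^ 3 ≤ 256 * K ^ 6 * E := by
  have step : (n ^ 5 / 4) ^ 2 * ρ ≤ (K * n) * (K * n) * E * (4 * n ^ 6) := by
    have a1 : (n ^ 5 / 4) ^ 2 ≤ wr ^ 2 := by gcongr
    calc (n ^ 5 / 4) ^ 2 * ρ ≤ (w * r) * ρ := by
          gcongr; exact a1.trans h4
      _ ≤ (((K * n) * (K * n) * E) * r) * ρ := by gcongr
      _ = ((K * n) * (K * n) * E) * (ρ * r) := by ring
      _ ≤ _ := by gcongr
  have step2 : (n ^ 5 / 4) ^ 2 * n ≤ (K * n) * (K * n) * E * (4 * n ^ 6) * (4 * K ^ 4) := by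
    calc (n ^ 5 / 4) ^ 2 * n = (n ^ 5 / 4) ^ 2 * ρ * (4 * K ^ 4) := by rw [mul_assoc, hρ']
      _ ≤ _ := by gcongr
  have hn8 : 0 < n ^ 8 / 16 := by positivity
  refine le_of_mul_le_mul_left ?_ hn8
  calc n ^ 8 / 16 * n ^ 3 = (n ^ 5 / 4) ^ 2 * n := by ring
    _ ≤ _ := step2
    _ = _ := by ring

set_option maxHeartbeats 1000000 in
lemma energy_lb (A : Finset F) (K : ℝ) (hK : 1 ≤ K) (h0 : (0 : F) ∉ A)
    (hS : ((A + A).card : ℝ) ≤ K * A.card) (hT : ((A⁻¹ + A⁻¹).card : ℝ) ≤ K * A.card)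
    (hn : 24 * K ^ 4 ≤ A.card) :
    (A.card : ℝ) ^ 3 ≤ 256 * K ^ 6 * (EQ (A + A) (A⁻¹ + A⁻¹)).card := by
  set S := A + A with hSd
  set T := A⁻¹ + A⁻¹ with hTd
  set n : ℝ := (A.card : ℝ) with hnd
  set ρ : ℝ := n / (4 * K ^ 4) with hρ
  have hK0 : 0 < K := by linarith
  have hK4 : 1 ≤ K ^ 4 := one_le_pow₀ hK
  have hn24 : 24 ≤ n := by nlinarith
  have hn0 : 0 < n := by linarith
  have hρ6 : 6 ≤ ρ := by rw [hρ, le_div_iff₀ (by positivity)]; linarith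
  set Wd := S ×ˢ T ×ˢ S ×ˢ T with hWd
  have hmaps : ∀ p ∈ PP A, word p ∈ Wd := by
    rintro ⟨a0, a1, a2, a3, a4⟩ h
    simp only [PP, Finset.mem_filter, Finset.mem_product] at h
    obtain ⟨⟨m0, m1, m2, m3, m4⟩, -⟩ := h
    simp only [hWd, word, Finset.mem_product]
    exact ⟨Finset.add_mem_add m3 m4, Finset.add_mem_add (Finset.inv_mem_inv m2) (Finset.inv_mem_inv m3),
      Finset.add_mem_add m1 m2, Finset.add_mem_add (Finset.inv_mem_inv m0) (Finset.inv_mem_inv m1)⟩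
  set fib : F × F × F × F → ℕ := fun w => ((PP A).filter fun p => word p = w).card with hfib
  have hsum : ((PP A).card : ℝ) = ∑ w ∈ Wd, (fib w : ℝ) := by
    rw [Finset.card_eq_sum_card_fiberwise (f := word) (t := Wd) hmaps]
    push_cast
    rfl
  set Ω := Wd.filter fun w => ρ ≤ fib w with hΩ
  have hWdcard : (Wd.card : ℝ) ≤ K ^ 4 * n ^ 4 := by
    have : (Wd.card : ℝ) = S.card * (T.card * (S.card * T.card)) := by
      simp [hWd, Finset.card_product]
    rw [this]
    calc (S.card : ℝ) * (T.card * (S.card * T.card)) ≤ (K * n) * ((K * n) * ((K * n) * (K * n))) := by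
          gcongr
      _ = _ := by ring
  have hPP : n ^ 5 / 2 ≤ (PP A).card := by
    have := PP_card A
    have h' : n ^ 5 ≤ (PP A).card + n ^ 4 := by rw [hnd]; exact_mod_cast this
    have : n ^ 5 = n * n ^ 4 := by ring
    have : 0 < n ^ 4 := by positivity
    nlinarith
  have hΩsum : n ^ 5 / 4 ≤ ∑ w ∈ Ω, (fib w : ℝ) := by
    have h1 := Finset.sum_filter_add_sum_filter_not Wd (fun w => ρ ≤ fib w) (fun w => (fib w : ℝ))
    have h2 : ∑ w ∈ Wd.filter (fun w => ¬ ρ ≤ fib w), (fib w : ℝ) ≤ n ^ 5 / 4 := by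
      calc _ ≤ ∑ w ∈ Wd.filter (fun w => ¬ ρ ≤ fib w), ρ := by
            apply Finset.sum_le_sum
            intro w hw
            simp only [Finset.mem_filter] at hw
            linarith [hw.2]
        _ = (Wd.filter (fun w => ¬ ρ ≤ fib w)).card * ρ := by simp
        _ ≤ (K ^ 4 * n ^ 4) * ρ := by
            gcongr
            exact le_trans (by exact_mod_cast Finset.card_filter_le _ _) hWdcard
        _ = n ^ 5 / 4 := by rw [hρ]; field_simp
    linarith
  have hΩkey : ∀ w ∈ Ω, w ∈ Wd ∧ (key w).1 ≠ 0 := by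
    intro w hw
    simp only [hΩ, Finset.mem_filter] at hw
    refine ⟨hw.1, ?_⟩
    have : 0 < fib w := by
      have : (0 : ℝ) < fib w := by linarith [hw.2]
      exact_mod_cast this
    obtain ⟨p, hp⟩ := Finset.card_pos.1 this
    simp only [PP, Finset.mem_filter] at hp
    rw [← hp.2]
    exact hp.1.2
  set M := Ω.image key with hM
  set R : F × F × F → ℝ := fun m => ((RS A m).card : ℝ) with hR
  set W : F × F × F → ℝ := fun m => ((Ω.filter fun w => key w = m).card : ℝ) with hW
  have hRρ : ∀ m ∈ M, ρ ≤ R m := by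
    intro m hm
    obtain ⟨w, hw, rfl⟩ := Finset.mem_image.1 hm
    simp only [hΩ, Finset.mem_filter] at hw
    refine hw.2.trans ?_
    simp only [hR, hfib]
    exact_mod_cast fiber_le A h0 w
  have hM0 : ∀ m ∈ M, m.1 ≠ 0 := by
    intro m hm
    obtain ⟨w, hw, rfl⟩ := Finset.mem_image.1 hm
    exact (hΩkey w hw).2
  have hWR : n ^ 5 / 4 ≤ ∑ m ∈ M, W m * R m := by
    calc n ^ 5 / 4 ≤ ∑ w ∈ Ω, (fib w : ℝ) := hΩsum
      _ ≤ ∑ w ∈ Ω, R (key w) := by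
          apply Finset.sum_le_sum
          intro w _
          simp only [hR, hfib]
          exact_mod_cast fiber_le A h0 w
      _ = ∑ m ∈ M, ∑ w ∈ Ω with key w = m, R (key w) := by
          rw [Finset.sum_fiberwise_of_maps_to]
          intro w hw
          exact Finset.mem_image_of_mem _ hw
      _ = ∑ m ∈ M, W m * R m := by
          apply Finset.sum_congr rfl
          intro m _
          rw [Finset.sum_congr rfl (g := fun _ => R m)]
          · simp [hW]
          · intro w hw
            rw [(Finset.mem_filter.1 hw).2]
  have hR2 : ρ * ∑ m ∈ M, R m ^ 2 ≤ 4 * n ^ 6 := by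
    rw [Finset.mul_sum]
    calc ∑ m ∈ M, ρ * R m ^ 2 ≤ ∑ m ∈ M, 2 * ((TR A m).card : ℝ) := by
          apply Finset.sum_le_sum
          intro m hm
          have h1 := hRρ m hm
          have h6 : 6 ≤ (RS A m).card := by
            have : (6 : ℝ) ≤ (RS A m).card := hρ6.trans h1
            exact_mod_cast this
          have h3 := triple_lb (RS A m) h6
          have h3' : R m ^ 3 ≤ 2 * ((TR A m).card : ℝ) := by
            simp only [hR, TR]
            exact_mod_cast h3
          nlinarith [sq_nonneg (R m)]
      _ = 2 * ((∑ m ∈ M, (TR A m).card : ℕ) : ℝ) := by push_cast; rw [Finset.mul_sum]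
      _ ≤ 2 * ((2 * A.card ^ 6 : ℕ) : ℝ) := by
          gcongr
          exact sum_TR A M hM0
      _ = 4 * n ^ 6 := by push_cast; ring
  have hW2 : ∑ m ∈ M, W m ^ 2 ≤ (K * n) * (K * n) * (EQ S T).card := by
    have h1 := pairs_le S T Ω hΩkey
    have h2 : ∑ m ∈ M, W m ^ 2 = (((Ω ×ˢ Ω).filter fun x => key x.1 = key x.2).card : ℝ) := by
      rw [Finset.card_eq_sum_card_fiberwise (f := fun x => key x.1) (t := M)]
      · push_cast
        apply Finset.sum_congr rfl
        intro m _
        simp only [hW]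
        rw [sq, ← Nat.cast_mul, ← Finset.card_product]
        congr 2
        ext ⟨x, y⟩
        simp only [Finset.mem_product, Finset.mem_filter]
        constructor
        · rintro ⟨⟨a, b⟩, c, d⟩
          exact ⟨⟨⟨a, c⟩, by rw [b, d]⟩, b⟩
        · rintro ⟨⟨⟨a, c⟩, e⟩, b⟩
          exact ⟨⟨a, b⟩, c, by rw [← e, b]⟩
      · rintro ⟨x, y⟩ hx
        simp only [Finset.coe_filter, Finset.mem_product, Set.mem_ofPred_eq] at hx
        exact Finset.mem_coe.2 (Finset.mem_image_of_mem _ hx.1.1)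
    rw [h2]
    calc _ ≤ ((S.card * T.card * (EQ S T).card : ℕ) : ℝ) := by exact_mod_cast h1
      _ = (S.card : ℝ) * T.card * (EQ S T).card := by push_cast; ring
      _ ≤ _ := by gcongr
  have hCS := Finset.sum_mul_sq_le_sq_mul_sq M W R
  have hR20 : 0 ≤ ∑ m ∈ M, R m ^ 2 := Finset.sum_nonneg fun _ _ => sq_nonneg _
  have hρ' : ρ * (4 * K ^ 4) = n := by rw [hρ]; field_simp
  exact energy_arith n K ρ _ _ _ _ hn0 hK0 (by linarith) hρ' (Nat.cast_nonneg _) hR20 hWR hR2 hW2 hCS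

def pop (T : Finset F) (r : F) : Finset F := T.filter fun t => t * r ∈ T

lemma EQ_le (S T : Finset F) (hS0 : (0 : F) ∉ S) :
    (EQ S T).card ≤ ∑ s1 ∈ S, ∑ s ∈ S, (pop T (s / s1)).card := by
  rw [← Finset.sum_product']
  rw [Finset.card_eq_sum_card_fiberwise (f := fun x => (x.2.2, x.1.2)) (t := S ×ˢ S)]
  · apply Finset.sum_le_sum
    rintro ⟨s1, s⟩ hs
    simp only [Finset.mem_product] at hs
    have hs1 : s1 ≠ 0 := by rintro rfl; exact hS0 hs.1
    apply Finset.card_le_card_of_injOn (fun x => x.1.1)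
    · rintro ⟨⟨a, b⟩, ⟨c, d⟩⟩ h
      simp only [EQ, Finset.coe_filter, Finset.mem_filter, Finset.mem_product, Set.mem_ofPred_eq,
        Prod.mk.injEq] at h
      obtain ⟨⟨⟨⟨ha, hb⟩, hc, hd⟩, he⟩, rfl, rfl⟩ := h
      simp only [pop, Finset.coe_filter, Set.mem_ofPred_eq]
      refine ⟨ha, ?_⟩
      have : a * (b / d) = c := by
        field_simp
        linear_combination he
      rwa [this]
    · rintro ⟨⟨a, b⟩, ⟨c, d⟩⟩ h ⟨⟨a', b'⟩, ⟨c', d'⟩⟩ h' heq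
      simp only [EQ, Finset.coe_filter, Finset.mem_filter, Finset.mem_product, Set.mem_ofPred_eq,
        Prod.mk.injEq] at h h' heq
      obtain ⟨⟨-, he⟩, rfl, rfl⟩ := h
      obtain ⟨⟨-, he'⟩, rfl, rfl⟩ := h'
      subst heq
      have : c = c' := by
        apply mul_right_cancel₀ hs1
        rw [← he, ← he']
      subst this
      rfl
  · rintro ⟨⟨a, b⟩, ⟨c, d⟩⟩ h
    simp only [EQ, Finset.coe_filter, Finset.mem_product, Set.mem_ofPred_eq] at h
    simp only [Finset.coe_product, Set.mem_prod, Finset.mem_coe]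
    tauto

lemma exists_X (S T : Finset F) (n K : ℝ) (hK : 1 ≤ K) (hn : 0 < n) (hS0 : (0 : F) ∉ S)
    (hSne : S.Nonempty) (hTne : T.Nonempty)
    (hS : (S.card : ℝ) ≤ K * n) (hT : (T.card : ℝ) ≤ K * n) (hTn : n ≤ T.card)
    (hE : n ^ 3 ≤ 256 * K ^ 6 * (EQ S T).card) :
    ∃ s0 ∈ S, ∃ t0 ∈ T, ∃ X : Finset F, 1 ∈ X ∧ n / (512 * K ^ 8) ≤ X.card ∧
      ∀ x ∈ X, x * s0 ∈ S ∧ t0 * x ∈ T ∧ n / (512 * K ^ 8) ≤ (pop T x).card := by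
  have hK0 : 0 < K := by linarith
  set ρ : ℝ := n / (512 * K ^ 8) with hρ
  have hρn : ρ ≤ n := by
    rw [hρ]; apply div_le_self hn.le
    have : 1 ≤ K ^ 8 := one_le_pow₀ hK
    linarith
  have h1 : ∃ s0 ∈ S, n ^ 2 / (256 * K ^ 7) ≤ ∑ s ∈ S, ((pop T (s / s0)).card : ℝ) := by
    apply Finset.exists_le_of_sum_le hSne
    have h := EQ_le S T hS0
    have h' : ((EQ S T).card : ℝ) ≤ ∑ s1 ∈ S, ∑ s ∈ S, ((pop T (s / s1)).card : ℝ) := by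
      exact_mod_cast h
    refine le_trans ?_ h'
    rw [Finset.sum_const, nsmul_eq_mul]
    have : n ^ 3 / (256 * K ^ 6) ≤ (EQ S T).card := by
      rw [div_le_iff₀ (by positivity)]; linarith
    refine le_trans ?_ this
    calc (S.card : ℝ) * (n ^ 2 / (256 * K ^ 7)) ≤ (K * n) * (n ^ 2 / (256 * K ^ 7)) := by gcongr
      _ = _ := by field_simp
  obtain ⟨s0, hs0, h1⟩ := h1
  have hs00 : s0 ≠ 0 := by rintro rfl; exact hS0 hs0
  set S' := S.filter fun s => ρ ≤ (pop T (s / s0)).card with hS'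
  have h2 : n ^ 2 / (512 * K ^ 7) ≤ ∑ s ∈ S', ((pop T (s / s0)).card : ℝ) := by
    have a1 := Finset.sum_filter_add_sum_filter_not S (fun s => ρ ≤ (pop T (s / s0)).card)
      (fun s => ((pop T (s / s0)).card : ℝ))
    have a2 : ∑ s ∈ S.filter (fun s => ¬ ρ ≤ (pop T (s / s0)).card), ((pop T (s / s0)).card : ℝ)
        ≤ n ^ 2 / (512 * K ^ 7) := by
      calc _ ≤ ∑ s ∈ S.filter (fun s => ¬ ρ ≤ (pop T (s / s0)).card), ρ := by
            apply Finset.sum_le_sum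
            intro w hw
            simp only [Finset.mem_filter] at hw
            linarith [hw.2]
        _ = (S.filter (fun s => ¬ ρ ≤ (pop T (s / s0)).card)).card * ρ := by simp
        _ ≤ (K * n) * ρ := by
            gcongr
            exact le_trans (by exact_mod_cast Finset.card_filter_le _ _) hS
        _ = _ := by rw [hρ]; field_simp
    have a3 : n ^ 2 / (256 * K ^ 7) = n ^ 2 / (512 * K ^ 7) + n ^ 2 / (512 * K ^ 7) := by
      field_simp; norm_num
    linarith
  have h3 : ∃ t0 ∈ T, ρ ≤ ((S'.filter fun s => t0 * (s / s0) ∈ T).card : ℝ) := by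
    apply Finset.exists_le_of_sum_le hTne
    have e := Finset.sum_card_bipartiteAbove_eq_sum_card_bipartiteBelow
      (fun (s t : F) => t * (s / s0) ∈ T) (s := S') (t := T)
    have e' : ∑ t ∈ T, ((S'.filter fun s => t * (s / s0) ∈ T).card : ℝ)
        = ∑ s ∈ S', ((pop T (s / s0)).card : ℝ) := by
      exact_mod_cast e.symm
    rw [e']
    refine le_trans ?_ h2
    rw [Finset.sum_const, nsmul_eq_mul]
    calc (T.card : ℝ) * ρ ≤ (K * n) * ρ := by gcongr
      _ = _ := by rw [hρ]; field_simp
  obtain ⟨t0, ht0, h3⟩ := h3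
  refine ⟨s0, hs0, t0, ht0, insert 1 ((S'.filter fun s => t0 * (s / s0) ∈ T).image (fun s => s / s0)),
    Finset.mem_insert_self _ _, ?_, ?_⟩
  · refine h3.trans ?_
    have : ((S'.filter fun s => t0 * (s / s0) ∈ T).image (fun s => s / s0)).card
        = (S'.filter fun s => t0 * (s / s0) ∈ T).card := by
      apply Finset.card_image_of_injective
      intro a b h
      exact (div_left_inj' hs00).1 h
    rw [← this]
    exact_mod_cast Finset.card_le_card (Finset.subset_insert _ _)
  · intro x hx
    rcases Finset.mem_insert.1 hx with rfl | hx
    · refine ⟨by simpa using hs0, by simpa using ht0, ?_⟩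
      have : pop T (1 : F) = T := by simp [pop]
      rw [this]
      linarith
    · obtain ⟨s, hs, rfl⟩ := Finset.mem_image.1 hx
      simp only [hS', Finset.mem_filter] at hs
      refine ⟨?_, hs.2, hs.1.2⟩
      rw [div_mul_cancel₀ _ hs00]
      exact hs.1.1

/-! Good multipliers. -/

def Good (T : Finset F) (M : ℝ) (r : F) : Prop :=
  ∃ Z : Finset F, (Z.card : ℝ) ≤ M ∧ ∀ t ∈ T, ∃ z ∈ Z, ∃ a ∈ T, ∃ b ∈ T, r * t = z + (a - b)

/-- `2T - 2T` is covered by translates of `T - T`. -/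
def Cov (T : Finset F) (K0 : ℝ) : Prop :=
  ∃ Z : Finset F, (Z.card : ℝ) ≤ K0 ∧ ∀ a ∈ T, ∀ b ∈ T, ∀ c ∈ T, ∀ d ∈ T,
    ∃ z ∈ Z, ∃ a' ∈ T, ∃ b' ∈ T, (a - b) + (c - d) = z + (a' - b')

lemma Good.sub {T : Finset F} {M1 M2 K0 : ℝ} {r1 r2 : F} (hc : Cov T K0) (h1 : Good T M1 r1)
    (h2 : Good T M2 r2) : Good T (M1 * M2 * K0) (r1 - r2) := by
  obtain ⟨Z0, hZ0, c0⟩ := hc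
  obtain ⟨Z1, hZ1, c1⟩ := h1
  obtain ⟨Z2, hZ2, c2⟩ := h2
  refine ⟨(Z1 - Z2) + Z0, ?_, ?_⟩
  · have a1 : (((Z1 - Z2) + Z0).card : ℝ) ≤ (Z1 - Z2).card * Z0.card := by
      exact_mod_cast Finset.card_add_le
    have a2 : ((Z1 - Z2).card : ℝ) ≤ Z1.card * Z2.card := by exact_mod_cast Finset.card_sub_le
    have p1 : (0 : ℝ) ≤ M1 := (Nat.cast_nonneg _).trans hZ1
    have p2 : (0 : ℝ) ≤ M2 := (Nat.cast_nonneg _).trans hZ2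
    calc _ ≤ _ := a1
      _ ≤ (Z1.card * Z2.card) * Z0.card := by gcongr
      _ ≤ _ := by gcongr
  · intro t ht
    obtain ⟨z1, hz1, a, ha, b, hb, e1⟩ := c1 t ht
    obtain ⟨z2, hz2, c, hc, d, hd, e2⟩ := c2 t ht
    obtain ⟨z, hz, a', ha', b', hb', e⟩ := c0 a ha b hb d hd c hc
    refine ⟨z1 - z2 + z, Finset.add_mem_add (Finset.sub_mem_sub hz1 hz2) hz, a', ha', b', hb', ?_⟩
    linear_combination e1 - e2 + e

lemma Good.neg_one {T : Finset F} (hT : T.Nonempty) : Good T 1 (-1) := by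
  obtain ⟨t1, ht1⟩ := hT
  refine ⟨{-t1}, by simp, fun t ht => ⟨-t1, by simp, t1, ht1, t, ht, by ring⟩⟩

lemma Good.mul {T : Finset F} {M1 M2 K0 : ℝ} {r1 r2 : F} (hc : Cov T K0) (h1 : Good T M1 r1)
    (h2 : Good T M2 r2) : Good T (M1 ^ 2 * M2 * K0) (r1 * r2) := by
  obtain ⟨Z0, hZ0, c0⟩ := hc
  obtain ⟨Z1, hZ1, c1⟩ := h1
  obtain ⟨Z2, hZ2, c2⟩ := h2
  refine ⟨((Z1 - Z1) + Z2.image (fun z => r1 * z)) + Z0, ?_, ?_⟩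
  · have a1 : ((((Z1 - Z1) + Z2.image (fun z => r1 * z)) + Z0).card : ℝ) ≤
        ((Z1 - Z1) + Z2.image (fun z => r1 * z)).card * Z0.card := by
      exact_mod_cast Finset.card_add_le
    have a2 : (((Z1 - Z1) + Z2.image (fun z => r1 * z)).card : ℝ) ≤
      (Z1 - Z1).card * (Z2.image (fun z => r1 * z)).card := by exact_mod_cast Finset.card_add_le
    have a3 : ((Z1 - Z1).card : ℝ) ≤ Z1.card * Z1.card := by exact_mod_cast Finset.card_sub_le
    have a4 : ((Z2.image (fun z => r1 * z)).card : ℝ) ≤ Z2.card := by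
      exact_mod_cast Finset.card_image_le
    have p1 : (0 : ℝ) ≤ M1 := (Nat.cast_nonneg _).trans hZ1
    have p2 : (0 : ℝ) ≤ M2 := (Nat.cast_nonneg _).trans hZ2
    calc _ ≤ _ := a1
      _ ≤ ((Z1.card * Z1.card) * Z2.card) * Z0.card := by
        gcongr
        refine a2.trans ?_
        gcongr
      _ ≤ ((M1 * M1) * M2) * K0 := by gcongr
      _ = _ := by ring
  · intro t ht
    obtain ⟨z2, hz2, a, ha, b, hb, e⟩ := c2 t ht
    obtain ⟨za, hza, a1, ha1, a2, ha2, ea⟩ := c1 a ha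
    obtain ⟨zb, hzb, b1, hb1, b2, hb2, eb⟩ := c1 b hb
    obtain ⟨z, hz, a', ha', b', hb', e'⟩ := c0 a1 ha1 a2 ha2 b2 hb2 b1 hb1
    refine ⟨za - zb + r1 * z2 + z, Finset.add_mem_add (Finset.add_mem_add
      (Finset.sub_mem_sub hza hzb) (Finset.mem_image_of_mem _ hz2)) hz, a', ha', b', hb', ?_⟩
    linear_combination r1 * e + ea - eb + e'

lemma Good.of_card {T : Finset F} {M : ℝ} {r : F} (hT : T.Nonempty)
    (h : ((T + T.image (fun t => r * t)).card : ℝ) ≤ M * T.card) : Good T M r := by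
  rw [add_comm] at h
  obtain ⟨Z, -, hZ, hc⟩ := Finset.ruzsa_covering_add hT h
  refine ⟨Z, hZ, fun t ht => ?_⟩
  have := hc (Finset.mem_image_of_mem _ ht)
  obtain ⟨z, hz, y, hy, e⟩ := Finset.mem_add.1 this
  obtain ⟨a, ha, b, hb, rfl⟩ := Finset.mem_sub.1 hy
  exact ⟨z, hz, a, ha, b, hb, e.symm⟩

lemma Good.card {T : Finset F} {M : ℝ} {r : F} (h : Good T M r) :
    ((T + T.image (fun t => r * t)).card : ℝ) ≤ M * (T + T - T).card := by
  obtain ⟨Z, hZ, hc⟩ := h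
  have hs : T + T.image (fun t => r * t) ⊆ Z + (T + T - T) := by
    intro x hx
    obtain ⟨t, ht, y, hy, rfl⟩ := Finset.mem_add.1 hx
    obtain ⟨t', ht', rfl⟩ := Finset.mem_image.1 hy
    obtain ⟨z, hz, a, ha, b, hb, e⟩ := hc t' ht'
    refine Finset.mem_add.2 ⟨z, hz, t + a - b, Finset.sub_mem_sub (Finset.add_mem_add ht ha) hb, ?_⟩
    linear_combination -e
  calc ((T + T.image (fun t => r * t)).card : ℝ) ≤ (Z + (T + T - T)).card := by
        exact_mod_cast Finset.card_le_card hs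
    _ ≤ Z.card * (T + T - T).card := by exact_mod_cast Finset.card_add_le
    _ ≤ _ := by gcongr

lemma card_inv_mul (T : Finset F) {r : F} (hr : r ≠ 0) :
    (T + T.image (fun t => r⁻¹ * t)).card = (T + T.image (fun t => r * t)).card := by
  rw [← Finset.card_image_of_injective (T + T.image (fun t => r⁻¹ * t)) (mul_right_injective₀ hr)]
  congr 1
  ext x
  simp only [Finset.mem_image, Finset.mem_add]
  constructor
  · rintro ⟨_, ⟨t, ht, _, ⟨t', ht', rfl⟩, rfl⟩, rfl⟩
    refine ⟨t', ht', r * t, ⟨t, ht, rfl⟩, ?_⟩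
    field_simp
    ring
  · rintro ⟨t, ht, _, ⟨t', ht', rfl⟩, rfl⟩
    refine ⟨_, ⟨t', ht', _, ⟨t, ht, rfl⟩, rfl⟩, ?_⟩
    field_simp
    ring

lemma Good.inv {T : Finset F} {M K6 : ℝ} {r : F} (hT : T.Nonempty) (hr : r ≠ 0)
    (h6 : ((T + T - T).card : ℝ) ≤ K6 * T.card) (h : Good T M r) : Good T (M * K6) r⁻¹ := by
  apply Good.of_card hT
  rw [card_inv_mul T hr]
  have hM : 0 ≤ M := by
    obtain ⟨Z, hZ, -⟩ := h
    exact (Nat.cast_nonneg _).trans hZ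
  calc _ ≤ _ := h.card
    _ ≤ M * (K6 * T.card) := by gcongr
    _ = _ := by ring

/-- The three real cardinalities we need from Pluennecke. -/
lemma plun (A : Finset F) (K : ℝ) (hA : A.Nonempty)
    (hT : ((A + A).card : ℝ) ≤ K * A.card) (m k : ℕ) :
    ((m • A - k • A).card : ℝ) ≤ K ^ (m + k) * A.card := by
  have h := Finset.pluennecke_ruzsa_inequality_nsmul_sub_nsmul_add hA A m k
  have h' : ((m • A - k • A).card : ℝ) ≤ (((A + A).card : ℝ) / A.card) ^ (m + k) * A.card := by
    have := (NNRat.cast_le (K := ℝ)).2 h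
    push_cast at this
    exact this
  have hp : (0 : ℝ) < A.card := by exact_mod_cast hA.card_pos
  refine h'.trans ?_
  gcongr
  rw [div_le_iff₀ hp]
  exact hT

lemma T_bounds (B : Finset F) (K : ℝ) (hB : B.Nonempty)
    (hT : ((B + B).card : ℝ) ≤ K * B.card) :
    (((B + B) + (B + B)).card : ℝ) ≤ K ^ 4 * B.card ∧
    (((B + B) + (B + B) - (B + B)).card : ℝ) ≤ K ^ 6 * B.card ∧
    Cov (B + B) (K ^ 10) := by
  have e4 : (B + B) + (B + B) = 4 • B - 0 • B := by simp [succ_nsmul, add_assoc]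
  have e6 : (B + B) + (B + B) - (B + B) = 4 • B - 2 • B := by simp [succ_nsmul, add_assoc]
  have hKB : (B.card : ℝ) ≤ (B + B).card := by
    exact_mod_cast Finset.card_le_card_add_right hB
  have hK0 : 0 ≤ K := by
    have hp : (0 : ℝ) < B.card := by exact_mod_cast hB.card_pos
    by_contra hh
    push Not at hh
    nlinarith [Nat.cast_nonneg (α := ℝ) (B + B).card]
  refine ⟨?_, ?_, ?_⟩
  · rw [e4]; exact plun B K hB hT 4 0
  · rw [e6]; exact plun B K hB hT 4 2
  · set T := B + B with hTdef
    have hTne : T.Nonempty := hB.add hB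
    have e10 : ((T - T) + (T - T)) + T = 6 • B - 4 • B := by
      simp only [hTdef, succ_nsmul, zero_nsmul, zero_add, sub_eq_add_neg, neg_add_rev]
      generalize -B = D
      abel
    have hc : (((((T - T) + (T - T)) + T).card : ℕ) : ℝ) ≤ K ^ 10 * T.card := by
      rw [e10]
      refine (plun B K hB hT 6 4).trans ?_
      gcongr
    obtain ⟨Z, -, hZ, hcov⟩ := Finset.ruzsa_covering_add hTne hc
    refine ⟨Z, hZ, fun a ha b hb c hc d hd => ?_⟩
    have := hcov (Finset.add_mem_add (Finset.sub_mem_sub ha hb) (Finset.sub_mem_sub hc hd))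
    obtain ⟨z, hz, y, hy, e⟩ := Finset.mem_add.1 this
    obtain ⟨a', ha', b', hb', rfl⟩ := Finset.mem_sub.1 hy
    exact ⟨z, hz, a', ha', b', hb', e.symm⟩

lemma good_of_pop (T : Finset F) (n K : ℝ) (x : F) (hx : x ≠ 0) (hK : 1 ≤ K) (hn : 0 < n)
    (hTne : T.Nonempty) (hTn : n ≤ T.card) (hTT : ((T + T).card : ℝ) ≤ K ^ 4 * n)
    (hpop : n / (512 * K ^ 8) ≤ (pop T x).card) : Good T (512 * K ^ 16) x := by
  apply Good.of_card hTne
  set I := (pop T x).image (fun t => x * t) with hI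
  have hIc : I.card = (pop T x).card := Finset.card_image_of_injective _ (mul_right_injective₀ hx)
  have tri := Finset.ruzsa_triangle_inequality_add_add_add T I (T.image (fun t => x * t))
  have s1 : (T + I).card ≤ (T + T).card := by
    apply Finset.card_le_card
    apply Finset.add_subset_add_left
    intro y hy
    obtain ⟨t, ht, rfl⟩ := Finset.mem_image.1 hy
    have := (Finset.mem_filter.1 ht).2
    rwa [mul_comm] at this
  have s2 : (I + T.image (fun t => x * t)).card ≤ (T + T).card := by
    rw [← Finset.card_image_of_injective (T + T) (mul_right_injective₀ hx)]
    apply Finset.card_le_card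
    intro y hy
    obtain ⟨u, hu, v, hv, rfl⟩ := Finset.mem_add.1 hy
    obtain ⟨t, ht, rfl⟩ := Finset.mem_image.1 hu
    obtain ⟨t', ht', rfl⟩ := Finset.mem_image.1 hv
    refine Finset.mem_image.2 ⟨t + t', Finset.add_mem_add (Finset.mem_filter.1 ht).1 ht', by ring⟩
  have hK0 : 0 < K := by linarith
  have tri' : ((T + T.image (fun t => x * t)).card : ℝ) * I.card ≤ (K ^ 4 * n) * (K ^ 4 * n) := by
    have : ((T + T.image (fun t => x * t)).card : ℝ) * I.card ≤
      (T + I).card * (I + T.image (fun t => x * t)).card := by exact_mod_cast tri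
    refine this.trans ?_
    have s1' : ((T + I).card : ℝ) ≤ (T + T).card := by exact_mod_cast s1
    have s2' : ((I + T.image (fun t => x * t)).card : ℝ) ≤ (T + T).card := by exact_mod_cast s2
    exact mul_le_mul (s1'.trans hTT) (s2'.trans hTT) (by positivity) (by positivity)
  rw [hIc] at tri'
  have : ((T + T.image (fun t => x * t)).card : ℝ) * (n / (512 * K ^ 8)) ≤ (K ^ 4 * n) * (K ^ 4 * n) :=
    le_trans (by gcongr) tri'
  have h2 : ((T + T.image (fun t => x * t)).card : ℝ) ≤ 512 * K ^ 16 * n := by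
    rw [← mul_div_assoc, div_le_iff₀ (by positivity)] at this
    have h3 : ((T + T.image (fun t => x * t)).card : ℝ) * n ≤ (512 * K ^ 16 * n) * n := by
      calc _ ≤ _ := this
        _ = _ := by ring
    exact le_of_mul_le_mul_right h3 hn
  exact h2.trans (by gcongr)

lemma Good.mono {T : Finset F} {M M' : ℝ} {r : F} (h : Good T M r) (hM : M ≤ M') : Good T M' r := by
  obtain ⟨Z, hZ, hc⟩ := h
  exact ⟨Z, hZ.trans hM, hc⟩

lemma Good.zero {T : Finset F} : Good T 1 0 :=
  ⟨{0}, by simp, fun t ht => ⟨0, by simp, t, ht, t, ht, by ring⟩⟩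

lemma good_quot {T X : Finset F} {K : ℝ} (hTne : T.Nonempty) (hcov : Cov T (K ^ 10))
    (h6 : ((T + T - T).card : ℝ) ≤ K ^ 6 * T.card)
    (hX : ∀ x ∈ X, Good T (512 * K ^ 16) x) {r : F} (hr : r ∈ quotSet X) :
    Good T (512 ^ 6 * K ^ 142) r := by
  obtain ⟨x1, h1, x2, h2, x3, h3, x4, h4, hne, rfl⟩ := hr
  have hn := Good.sub hcov (hX _ h1) (hX _ h2)
  have hd := Good.inv hTne (sub_ne_zero.2 hne) h6 (Good.sub hcov (hX _ h3) (hX _ h4))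
  have := Good.mul hcov hn hd
  rw [div_eq_mul_inv]
  exact this.mono (le_of_eq (by ring))

lemma good_all {T X : Finset F} {K : ℝ} (hK : 1 ≤ K) (hTne : T.Nonempty) (hcov : Cov T (K ^ 10))
    (h6 : ((T + T - T).card : ℝ) ≤ K ^ 6 * T.card)
    (hX : ∀ x ∈ X, Good T (512 * K ^ 16) x) {r q : F} (hq : q ∈ quotSet X)
    (hr : r = q ∨ r = q + 1 ∨ ∃ x ∈ X, r = x * q) :
    Good T (512 ^ 8 * K ^ 184) r := by
  have hg := good_quot hTne hcov h6 hX hq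
  have hK0 : 0 < K := by linarith
  rcases hr with rfl | rfl | ⟨x, hx, rfl⟩
  · apply hg.mono
    gcongr <;> norm_num
  · have := Good.sub hcov hg (Good.neg_one hTne)
    rw [sub_neg_eq_add] at this
    apply this.mono
    calc _ = 512 ^ 6 * K ^ 152 := by ring
      _ ≤ _ := by gcongr <;> norm_num
  · exact (Good.mul hcov (hX x hx) hg).mono (le_of_eq (by ring))

/-! Field lemma. -/

lemma sumset_of_notMem (X : Finset F) (r : F) (hr : r ∉ quotSet X) :
    (X + X.image (fun x => r * x)).card = X.card ^ 2 := by
  have : X + X.image (fun x => r * x) = (X ×ˢ X).image (fun p => p.1 + r * p.2) := by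
    ext y
    simp only [Finset.mem_add, Finset.mem_image, Finset.mem_product, Prod.exists]
    constructor
    · rintro ⟨a, ha, _, ⟨b, hb, rfl⟩, rfl⟩
      exact ⟨a, b, ⟨ha, hb⟩, rfl⟩
    · rintro ⟨a, b, ⟨ha, hb⟩, rfl⟩
      exact ⟨a, ha, _, ⟨b, hb, rfl⟩, rfl⟩
  rw [this, Finset.card_image_of_injOn, Finset.card_product, sq]
  rintro ⟨a, b⟩ h ⟨a', b'⟩ h' e
  simp only [Finset.coe_product, Set.mem_prod, Finset.mem_coe] at h h' e
  by_cases hb : b = b'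
  · subst hb
    simpa using e
  · exfalso
    apply hr
    refine ⟨a', h'.1, a, h.1, b, h.2, b', h'.2, hb, ?_⟩
    rw [eq_div_iff (sub_ne_zero.2 hb)]
    linear_combination e

lemma sumset_le (X T : Finset F) (t0 r : F) (ht0 : t0 ≠ 0) (h : ∀ x ∈ X, t0 * x ∈ T) :
    (X + X.image (fun x => r * x)).card ≤ (T + T.image (fun x => r * x)).card := by
  rw [← Finset.card_image_of_injective (X + _) (mul_right_injective₀ ht0)]
  apply Finset.card_le_card
  intro y hy
  obtain ⟨u, hu, rfl⟩ := Finset.mem_image.1 hy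
  obtain ⟨a, ha, v, hv, rfl⟩ := Finset.mem_add.1 hu
  obtain ⟨b, hb, rfl⟩ := Finset.mem_image.1 hv
  refine Finset.mem_add.2 ⟨t0 * a, h a ha, r * (t0 * b), Finset.mem_image_of_mem _ (h b hb), by ring⟩

lemma field_of_closed [Fintype F] (X : Finset F) (h1 : 1 ∈ X) (hX0 : (0 : F) ∉ X) (hX2 : 2 ≤ X.card)
    (hadd : ∀ q ∈ quotSet X, q + 1 ∈ quotSet X)
    (hmul : ∀ q ∈ quotSet X, ∀ x ∈ X, x * q ∈ quotSet X) :
    ∃ G : Subfield F, (G : Set F) = quotSet X ∧ ∀ x ∈ X, x ∈ G := by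
  set Q := quotSet X with hQ
  have inj_surj : ∀ (N : Set F) (f : F → F), Function.Injective f → (∀ y ∈ N, f y ∈ N) →
      ∀ y ∈ N, ∃ z ∈ N, f z = y := by
    intro N f hf hN y hy
    have hfin : N.Finite := Set.toFinite N
    have : N.SurjOn f N := by
      have himg : f '' N = N := by
        apply Set.eq_of_subset_of_ncard_le
        · rintro _ ⟨z, hz, rfl⟩; exact hN z hz
        · rw [Set.ncard_image_of_injective _ hf]
        · exact hfin
      exact himg.ge
    exact this hy
  obtain ⟨u, hu, v, hv, huv⟩ := Finset.one_lt_card.1 hX2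
  have hQ0 : (0 : F) ∈ Q := ⟨u, hu, u, hu, u, hu, v, hv, huv, by simp⟩
  set N : Set F := {y | ∀ q ∈ Q, q + y ∈ Q} with hN
  have hNQ : ∀ y ∈ N, y ∈ Q := fun y hy => by simpa using hy 0 hQ0
  have N1 : (1 : F) ∈ N := hadd
  have N0 : (0 : F) ∈ N := fun q hq => by simpa using hq
  have Nadd : ∀ a ∈ N, ∀ b ∈ N, a + b ∈ N := fun a ha b hb q hq => by
    rw [← add_assoc]; exact hb _ (ha q hq)
  have Nneg : ∀ a ∈ N, -a ∈ N := fun a ha q hq => by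
    obtain ⟨z, hz, e⟩ := inj_surj Q (fun z => z + a) (add_left_injective a) ha q hq
    have : q + -a = z := by rw [← e]; ring
    rwa [this]
  have NX : ∀ x ∈ X, ∀ y ∈ N, x * y ∈ N := fun x hx y hy q hq => by
    have hx0 : x ≠ 0 := by rintro rfl; exact hX0 hx
    obtain ⟨z, hz, e⟩ := inj_surj Q (fun z => x * z) (mul_right_injective₀ hx0)
      (fun q hq => hmul q hq x hx) q hq
    have : q + x * y = x * (z + y) := by rw [← e]; ring
    rw [this]
    exact hmul _ (hy z hz) x hx
  let G : Subfield F :=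
    { carrier := {g | ∀ y ∈ N, g * y ∈ N}
      mul_mem' := fun {a b} ha hb y hy => by
        rw [mul_assoc]; exact ha _ (hb y hy)
      one_mem' := fun y hy => by simpa using hy
      add_mem' := fun {a b} ha hb y hy => by
        rw [add_mul]; exact Nadd _ (ha y hy) _ (hb y hy)
      zero_mem' := fun y hy => by simpa using N0
      neg_mem' := fun {a} ha y hy => by
        rw [neg_mul]; exact Nneg _ (ha y hy)
      inv_mem' := fun a ha y hy => by
        by_cases h : a = 0
        · subst h; simpa using N0
        · obtain ⟨z, hz, e⟩ := inj_surj N (fun z => a * z) (mul_right_injective₀ h) ha y hy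
          have : a⁻¹ * y = z := by rw [← e]; field_simp
          rwa [this] }
  have hXG : ∀ x ∈ X, x ∈ G := fun x hx => NX x hx
  refine ⟨G, ?_, hXG⟩
  apply Set.Subset.antisymm
  · intro g hg
    have : g * 1 ∈ N := hg 1 N1
    rw [mul_one] at this
    exact hNQ g this
  · rintro _ ⟨x1, h1, x2, h2, x3, h3, x4, h4, hne, rfl⟩
    exact G.div_mem (G.sub_mem (hXG _ h1) (hXG _ h2)) (G.sub_mem (hXG _ h3) (hXG _ h4))

/-! Averaging. -/

def E2 (X : Finset F) (r : F) : Finset ((F × F) × (F × F)) :=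
  ((X ×ˢ X) ×ˢ (X ×ˢ X)).filter fun p => p.1.1 + r * p.1.2 = p.2.1 + r * p.2.2

lemma E2_cauchy (X : Finset F) (r : F) :
    X.card ^ 4 ≤ (X + X.image (fun x => r * x)).card * (E2 X r).card := by
  have hmap : ∀ p ∈ X ×ˢ X, p.1 + r * p.2 ∈ X + X.image (fun x => r * x) := by
    rintro ⟨a, b⟩ h
    simp only [Finset.mem_product] at h
    exact Finset.add_mem_add h.1 (Finset.mem_image_of_mem _ h.2)
  have h1 : (X ×ˢ X).card = ∑ y ∈ X + X.image (fun x => r * x),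
      ((X ×ˢ X).filter fun p => p.1 + r * p.2 = y).card :=
    Finset.card_eq_sum_card_fiberwise hmap
  have h2 : (E2 X r).card = ∑ y ∈ X + X.image (fun x => r * x),
      ((X ×ˢ X).filter fun p => p.1 + r * p.2 = y).card ^ 2 := by
    rw [Finset.card_eq_sum_card_fiberwise (f := fun p => p.1.1 + r * p.1.2)
      (t := X + X.image (fun x => r * x))]
    · apply Finset.sum_congr rfl
      intro y hy
      rw [sq, ← Finset.card_product]
      congr 1
      ext ⟨⟨a, b⟩, ⟨c, d⟩⟩
      simp only [E2, Finset.mem_filter, Finset.mem_product]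
      constructor
      · rintro ⟨⟨⟨h1, h2⟩, h3⟩, h4⟩
        exact ⟨⟨h1, h4⟩, h2, h3 ▸ h4⟩
      · rintro ⟨⟨h1, h4⟩, h2, h3⟩
        exact ⟨⟨⟨h1, h2⟩, h4.trans h3.symm⟩, h4⟩
    · rintro ⟨⟨a, b⟩, ⟨c, d⟩⟩ h
      simp only [E2, Finset.coe_filter, Finset.mem_product, Set.mem_ofPred_eq] at h
      exact hmap (a, b) (Finset.mem_product.2 h.1.1)
  have := sq_sum_le_card_mul_sum_sq (s := X + X.image (fun x => r * x))
    (f := fun y => ((X ×ˢ X).filter fun p => p.1 + r * p.2 = y).card)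
  rw [← h1, ← h2, Finset.card_product] at this
  calc X.card ^ 4 = (X.card * X.card) ^ 2 := by ring
    _ ≤ _ := by exact_mod_cast this

lemma E2_sum (X G : Finset F) :
    ∑ r ∈ G, (E2 X r).card ≤ G.card * X.card ^ 2 + X.card ^ 4 := by
  have e := Finset.sum_card_bipartiteAbove_eq_sum_card_bipartiteBelow
      (fun (r : F) (p : (F × F) × (F × F)) => p.1.1 + r * p.1.2 = p.2.1 + r * p.2.2)
      (s := G) (t := (X ×ˢ X) ×ˢ (X ×ˢ X))
  have e' : ∑ r ∈ G, (E2 X r).card = ∑ p ∈ (X ×ˢ X) ×ˢ (X ×ˢ X),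
      (G.filter fun r => p.1.1 + r * p.1.2 = p.2.1 + r * p.2.2).card := e
  rw [e']
  have hb : ∀ p ∈ (X ×ˢ X) ×ˢ (X ×ˢ X),
      (G.filter fun r => p.1.1 + r * p.1.2 = p.2.1 + r * p.2.2).card ≤
        (if p.1 = p.2 then G.card else 0) + 1 := by
    rintro ⟨⟨a, b⟩, ⟨c, d⟩⟩ -
    split_ifs with h
    · exact (Finset.card_filter_le _ _).trans (Nat.le_succ _)
    · rw [zero_add]
      apply Finset.card_le_one.2
      intro r hr r' hr'
      simp only [Finset.mem_filter] at hr hr'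
      have hbd : b ≠ d := by
        rintro rfl
        apply h
        have : a = c := by linear_combination hr.2
        simp [this]
      apply mul_right_cancel₀ (sub_ne_zero.2 hbd)
      linear_combination hr.2 - hr'.2
  refine (Finset.sum_le_sum hb).trans ?_
  rw [Finset.sum_add_distrib, Finset.sum_product]
  have : ∀ x ∈ X ×ˢ X, ∑ y ∈ X ×ˢ X, (if x = y then G.card else 0) = G.card := by
    intro x hx
    rw [Finset.sum_ite_eq, if_pos hx]
  simp only
  rw [Finset.sum_congr rfl this]
  simp only [Finset.sum_const, Finset.card_product, smul_eq_mul, mul_one]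
  apply le_of_eq
  ring

/-- If every dilate sum is at most `W`, then `min(|X|^2,|G|) ≤ 2W`. -/
lemma averaging (X G : Finset F) (hX : X.Nonempty) (W : ℕ)
    (hW : ∀ r ∈ G, (X + X.image (fun x => r * x)).card ≤ W) :
    G.card * X.card ^ 2 ≤ W * (G.card + X.card ^ 2) := by
  have h1 : ∑ r ∈ G, X.card ^ 4 ≤ ∑ r ∈ G, W * (E2 X r).card :=
    Finset.sum_le_sum fun r hr => (E2_cauchy X r).trans (Nat.mul_le_mul_right _ (hW r hr))
  rw [← Finset.mul_sum, Finset.sum_const, smul_eq_mul] at h1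
  have h2 := h1.trans (Nat.mul_le_mul_left W (E2_sum X G))
  have hp : 0 < X.card ^ 2 := pow_pos hX.card_pos 2
  apply Nat.le_of_mul_le_mul_right _ hp
  calc _ = G.card * X.card ^ 4 := by ring
    _ ≤ _ := h2
    _ = _ := by ring

lemma averaging_real (X G : Finset F) (hX : X.Nonempty) (W : ℝ) (hW0 : 0 ≤ W)
    (hW : ∀ r ∈ G, ((X + X.image (fun x => r * x)).card : ℝ) ≤ W) :
    (G.card : ℝ) * (X.card : ℝ) ^ 2 ≤ W * (G.card + (X.card : ℝ) ^ 2) := by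
  have h := averaging X G hX ⌊W⌋₊ (fun r hr => Nat.le_floor (hW r hr))
  have h' : (G.card : ℝ) * (X.card : ℝ) ^ 2 ≤ (⌊W⌋₊ : ℝ) * (G.card + (X.card : ℝ) ^ 2) := by
    exact_mod_cast h
  refine h'.trans ?_
  gcongr
  exact Nat.floor_le hW0

/-- From `|X|^2 ≤ V W` to a bound on `n`. -/
lemma sq_bound {n K V x : ℝ} (hn : 0 < n) (hK : 1 ≤ K)
    (hx : n / (512 * K ^ 8) ≤ x) (h : x ^ 2 ≤ V * (512 ^ 8 * K ^ 190 * n)) :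
    n ≤ V * 512 ^ 10 * K ^ 206 := by
  have hK0 : 0 < K := by linarith
  have h1 : (n / (512 * K ^ 8)) ^ 2 ≤ V * (512 ^ 8 * K ^ 190 * n) :=
    le_trans (by gcongr) h
  rw [div_pow, div_le_iff₀ (by positivity)] at h1
  have h2 : n * n ≤ (V * 512 ^ 10 * K ^ 206) * n := by
    calc n * n = n ^ 2 := by ring
      _ ≤ _ := h1
      _ = _ := by ring
  exact le_of_mul_le_mul_right h2 hn

lemma pow_bound {n K C : ℝ} (hn : 0 < n) (hK : 1 ≤ K) (hC : 0 < C)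
    (h : n / (512 * K ^ 8) ≤ C * (K * n) ^ ((51 : ℝ) / 52)) :
    n ≤ (512 * C) ^ 52 * K ^ 467 := by
  have hK0 : 0 < K := by linarith
  rw [div_le_iff₀ (by positivity)] at h
  have h1 : n ^ 52 ≤ (C * (K * n) ^ ((51 : ℝ) / 52) * (512 * K ^ 8)) ^ 52 := by gcongr
  have e : ((K * n) ^ ((51 : ℝ) / 52)) ^ 52 = (K * n) ^ 51 := by
    rw [← Real.rpow_natCast, ← Real.rpow_mul (by positivity), ← Real.rpow_natCast]
    norm_num
  have h2 : n * n ^ 51 ≤ ((512 * C) ^ 52 * K ^ 467) * n ^ 51 := by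
    calc n * n ^ 51 = n ^ 52 := by ring
      _ ≤ _ := h1
      _ = C ^ 52 * ((K * n) ^ ((51 : ℝ) / 52)) ^ 52 * (512 * K ^ 8) ^ 52 := by ring
      _ = _ := by rw [e]; ring
  exact le_of_mul_le_mul_right h2 (by positivity)

def bigD (C : ℝ) : ℝ := (512 * (2 + C)) ^ 52

lemma bigD_one {C : ℝ} (hC : 0 < C) : (512 : ℝ) ^ 10 * (2 + C) ^ 2 ≤ bigD C := by
  have h12 : (1 : ℝ) ≤ 2 + C := by linarith
  rw [bigD, mul_pow]
  have h1 : (512 : ℝ) ^ 10 ≤ 512 ^ 52 := by norm_num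
  have h2 : (2 + C) ^ 2 ≤ (2 + C) ^ 52 := pow_le_pow_right₀ h12 (by norm_num)
  exact mul_le_mul h1 h2 (by positivity) (by positivity)

lemma bigD_two {C : ℝ} (hC : 0 < C) : (512 * C) ^ 52 ≤ bigD C := by
  rw [bigD]
  have : 512 * C ≤ 512 * (2 + C) := by linarith
  exact pow_le_pow_left₀ (by positivity) this 52

lemma bigD_three {C : ℝ} (hC : 0 < C) : (512 : ℝ) ^ 52 ≤ bigD C := by
  rw [bigD]
  have : (512 : ℝ) ≤ 512 * (2 + C) := by linarith
  exact pow_le_pow_left₀ (by positivity) this 52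

lemma core [Fintype F] (A : Finset F) (C K : ℝ) (hC : 0 < C) (hK : 1 ≤ K) (hA2 : 2 ≤ A.card)
    (h0 : (0 : F) ∉ A) (hS0 : (0 : F) ∉ A + A)
    (hS : ((A + A).card : ℝ) ≤ K * A.card) (hT : ((A⁻¹ + A⁻¹).card : ℝ) ≤ K * A.card)
    (hsub : subfieldCond (A + A)⁻¹ C (((A + A).card : ℝ) ^ ((51:ℝ)/52))) :
    (A.card : ℝ) ≤ bigD C * K ^ 467 ∨
    (Fintype.card F : ℝ) ≤ 2 * 512 ^ 8 * K ^ 190 * A.card := by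
  have hK0 : 0 < K := by linarith
  set n : ℝ := (A.card : ℝ) with hn
  have hn0 : 0 < n := by rw [hn]; exact_mod_cast (by omega : 0 < A.card)
  have hD512 := bigD_one hC
  have hDthree := bigD_two hC
  generalize bigD C = D at hD512 hDthree ⊢
  have hV1 : (1 : ℝ) ≤ (2 + C) ^ 2 := one_le_pow₀ (by linarith)
  have hV2 : (2 : ℝ) ≤ (2 + C) ^ 2 := by
    have : (2 + C) ^ 2 = 4 + 4 * C + C ^ 2 := by ring
    rw [this]
    have := sq_nonneg C
    linarith
  have hV3 : 1 + C ^ 2 ≤ (2 + C) ^ 2 := by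
    have : (2 + C) ^ 2 = 4 + 4 * C + C ^ 2 := by ring
    rw [this]
    linarith
  by_cases hsmall : n ≤ 1024 * K ^ 8
  · left
    refine hsmall.trans ?_
    have : (1024 : ℝ) ≤ D := by
      refine le_trans ?_ hD512
      calc (1024 : ℝ) ≤ 512 ^ 10 * 1 := by norm_num
        _ ≤ _ := by gcongr
    have h8 : K ^ 8 ≤ K ^ 467 := pow_le_pow_right₀ hK (by norm_num)
    exact mul_le_mul this h8 (by positivity) (by linarith)
  push Not at hsmall
  have hAne : A.Nonempty := Finset.card_pos.1 (by omega)
  have hBne : A⁻¹.Nonempty := hAne.inv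
  have hBcard : (A⁻¹).card = A.card := Finset.card_inv A
  set S := A + A with hSdef
  set T := A⁻¹ + A⁻¹ with hTdef
  have hSne : S.Nonempty := hAne.add hAne
  have hTne : T.Nonempty := hBne.add hBne
  have hTn : n ≤ T.card := by
    rw [hn, ← hBcard]
    exact_mod_cast Finset.card_le_card_add_right hBne
  have hT0 : (0 : F) ∉ T := by
    intro h
    obtain ⟨a', ha', b', hb', e⟩ := Finset.mem_add.1 h
    obtain ⟨a, ha, rfl⟩ := Finset.mem_inv.1 ha'
    obtain ⟨b, hb, rfl⟩ := Finset.mem_inv.1 hb'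
    apply hS0
    have ha0 : a ≠ 0 := by rintro rfl; exact h0 ha
    have hb0 : b ≠ 0 := by rintro rfl; exact h0 hb
    have : a + b = 0 := by
      field_simp at e
      linear_combination e
    rw [← this]
    exact Finset.add_mem_add ha hb
  have hE := energy_lb A K hK h0 hS hT (by
    have : K ^ 4 ≤ K ^ 8 := pow_le_pow_right₀ hK (by norm_num)
    have : 0 < K ^ 8 := by positivity
    linarith)
  obtain ⟨s0, hs0, t0, ht0, X, hX1, hXc, hX⟩ := exists_X S T n K hK hn0 hS0 hSne hTne hS hT hTn hE
  have hs00 : s0 ≠ 0 := by rintro rfl; exact hS0 hs0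
  have ht00 : t0 ≠ 0 := by rintro rfl; exact hT0 ht0
  have hX0 : (0 : F) ∉ X := fun h => by
    have := (hX 0 h).1
    rw [zero_mul] at this
    exact hS0 this
  have hX2 : 2 ≤ X.card := by
    have : (2 : ℝ) ≤ X.card := by
      refine le_trans ?_ hXc
      rw [le_div_iff₀ (by positivity)]
      linarith
    exact_mod_cast this
  obtain ⟨hT4, hT6, hcov⟩ := T_bounds A⁻¹ K hBne (by rw [hBcard]; exact hT)
  rw [hBcard] at hT4 hT6
  have h6 : ((T + T - T).card : ℝ) ≤ K ^ 6 * T.card := hT6.trans (by gcongr)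
  have hXgood : ∀ x ∈ X, Good T (512 * K ^ 16) x := fun x hx =>
    good_of_pop T n K x (by rintro rfl; exact hX0 hx) hK hn0 hTne hTn hT4 (hX x hx).2.2
  have hall : ∀ r q : F, q ∈ quotSet X → (r = q ∨ r = q + 1 ∨ ∃ x ∈ X, r = x * q) →
      ((X + X.image (fun x => r * x)).card : ℝ) ≤ 512 ^ 8 * K ^ 190 * n := by
    intro r q hq hr
    have hg := (good_all hK hTne hcov h6 hXgood hq hr).card
    have h1 : ((X + X.image (fun x => r * x)).card : ℝ) ≤ (T + T.image (fun x => r * x)).card := by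
      exact_mod_cast sumset_le X T t0 r ht00 (fun x hx => (hX x hx).2.1)
    calc _ ≤ _ := h1
      _ ≤ _ := hg
      _ ≤ 512 ^ 8 * K ^ 184 * (K ^ 6 * n) := by gcongr
      _ = _ := by ring
  have fin : ∀ V : ℝ, 0 ≤ V → V ≤ (2 + C) ^ 2 → (X.card : ℝ) ^ 2 ≤ V * (512 ^ 8 * K ^ 190 * n) →
      n ≤ D * K ^ 467 := by
    intro V hV0 hV h
    have := sq_bound hn0 hK hXc h
    calc n ≤ _ := this
      _ = (512 ^ 10 * V) * K ^ 206 := by ring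
      _ ≤ (512 ^ 10 * (2 + C) ^ 2) * K ^ 206 := by gcongr
      _ ≤ D * K ^ 206 := by gcongr
      _ ≤ D * K ^ 467 := by
        have hD0 : 0 ≤ D := le_trans (by positivity) hD512
        exact mul_le_mul_of_nonneg_left (pow_le_pow_right₀ hK (by norm_num)) hD0
  by_cases hcl : ∀ q ∈ quotSet X, q + 1 ∈ quotSet X ∧ ∀ x ∈ X, x * q ∈ quotSet X
  swap
  · left
    push Not at hcl
    obtain ⟨q, hq, hcl⟩ := hcl
    have : ∃ r, r ∉ quotSet X ∧ (r = q ∨ r = q + 1 ∨ ∃ x ∈ X, r = x * q) := by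
      by_cases hq1 : q + 1 ∈ quotSet X
      · obtain ⟨x, hx, hxq⟩ := hcl hq1
        exact ⟨x * q, hxq, Or.inr (Or.inr ⟨x, hx, rfl⟩)⟩
      · exact ⟨q + 1, hq1, Or.inr (Or.inl rfl)⟩
    obtain ⟨r, hr, hr'⟩ := this
    have h1 := hall r q hq hr'
    rw [sumset_of_notMem X r hr] at h1
    push_cast at h1
    exact fin 1 (by norm_num) hV1 (by rw [one_mul]; exact h1)
  obtain ⟨G, hGQ, hXG⟩ := field_of_closed X hX1 hX0 hX2 (fun q hq => (hcl q hq).1)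
    (fun q hq => (hcl q hq).2)
  set Gf : Finset F := Finset.univ.filter (fun g => g ∈ G) with hGf
  have hGfc : Gf.card = Nat.card G := by
    rw [Nat.card_eq_fintype_card, Fintype.card_subtype]
  have hav := averaging_real X Gf ⟨1, hX1⟩ (512 ^ 8 * K ^ 190 * n) (by positivity) (by
    intro r hr
    have hrG : r ∈ (G : Set F) := (Finset.mem_filter.1 hr).2
    rw [hGQ] at hrG
    exact hall r r hrG (Or.inl rfl))
  set W : ℝ := 512 ^ 8 * K ^ 190 * n with hWdef
  have hW0 : 0 < W := by positivity
  have hXpos : (0 : ℝ) < (X.card : ℝ) ^ 2 := by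
    have : 0 < X.card := by omega
    positivity
  have hGpos : (0 : ℝ) < Gf.card := by
    have : 0 < Gf.card := Finset.card_pos.2 ⟨1, by simp [hGf, G.one_mem]⟩
    exact_mod_cast this
  by_cases hGtop : G = ⊤
  · have hGq : (Gf.card : ℝ) = Fintype.card F := by
      have : Gf = Finset.univ := by
        ext x; simp [hGf, hGtop]
      rw [this, Finset.card_univ]
    rw [← hGq]
    rcases le_total ((X.card : ℝ) ^ 2) Gf.card with h | h
    · left
      apply fin 2 (by norm_num) hV2
      have : (Gf.card : ℝ) * (X.card : ℝ) ^ 2 ≤ Gf.card * (2 * W) := by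
        calc _ ≤ W * (Gf.card + (X.card : ℝ) ^ 2) := hav
          _ ≤ W * (Gf.card + Gf.card) := by gcongr
          _ = _ := by ring
      exact le_of_mul_le_mul_left this hGpos
    · right
      have : (X.card : ℝ) ^ 2 * (Gf.card : ℝ) ≤ (X.card : ℝ) ^ 2 * (2 * W) := by
        calc _ = (Gf.card : ℝ) * (X.card : ℝ) ^ 2 := by ring
          _ ≤ W * (Gf.card + (X.card : ℝ) ^ 2) := hav
          _ ≤ W * ((X.card : ℝ) ^ 2 + (X.card : ℝ) ^ 2) := by gcongr
          _ = _ := by ring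
      have := le_of_mul_le_mul_left this hXpos
      refine this.trans (le_of_eq ?_)
      rw [hWdef]
      ring
  · left
    have hs := hsub G hGtop s0⁻¹ 0
    have hXle : (X.card : ℝ) ≤ ((S⁻¹.filter fun x => ∃ g ∈ G, x = s0⁻¹ * g + 0).card : ℝ) := by
      have : X.card ≤ (S⁻¹.filter fun x => ∃ g ∈ G, x = s0⁻¹ * g + 0).card := by
        apply Finset.card_le_card_of_injOn (fun x => (x * s0)⁻¹)
        · intro x hx
          simp only [Finset.coe_filter, Set.mem_ofPred_eq]
          refine ⟨Finset.inv_mem_inv (hX x hx).1, x⁻¹, G.inv_mem (hXG x hx), ?_⟩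
          rw [mul_inv, add_zero, mul_comm]
        · intro x hx y hy e
          exact mul_right_cancel₀ hs00 (inv_injective e)
      exact_mod_cast this
    have hXle := hXle.trans (le_of_eq_of_le (by congr!) hs)
    rcases max_cases ((Nat.card G : ℝ) ^ ((1:ℝ)/2)) ((S.card : ℝ) ^ ((51:ℝ)/52)) with ⟨hm, -⟩ | ⟨hm, -⟩
    · rw [hm] at hXle
      have h1 : (X.card : ℝ) ^ 2 ≤ C ^ 2 * Gf.card := by
        calc (X.card : ℝ) ^ 2 ≤ (C * (Nat.card G : ℝ) ^ ((1:ℝ)/2)) ^ 2 := by gcongr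
          _ = C ^ 2 * ((Nat.card G : ℝ) ^ ((1:ℝ)/2)) ^ 2 := by ring
          _ = _ := by
            rw [← Real.sqrt_eq_rpow, Real.sq_sqrt (Nat.cast_nonneg _), hGfc]
      apply fin (1 + C ^ 2) (by positivity) hV3
      have : (Gf.card : ℝ) * (X.card : ℝ) ^ 2 ≤ Gf.card * ((1 + C ^ 2) * W) := by
        calc _ ≤ W * (Gf.card + (X.card : ℝ) ^ 2) := hav
          _ ≤ W * (Gf.card + C ^ 2 * Gf.card) := by gcongr
          _ = _ := by ring
      exact le_of_mul_le_mul_left this hGpos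
    · rw [hm] at hXle
      have h1 : n / (512 * K ^ 8) ≤ C * (K * n) ^ ((51 : ℝ) / 52) := by
        refine hXc.trans (hXle.trans ?_)
        gcongr
      refine (pow_bound hn0 hK hC h1).trans ?_
      exact mul_le_mul_of_nonneg_right hDthree (by positivity)

lemma final_arith {n K q c M : ℝ} (hn : 0 < n) (hK : 0 < K) (hq : 0 < q) (hc : 0 < c)
    (hM : M = K * n)
    (h : M < c * min (n ^ ((1:ℝ) + 1/831)) (q ^ ((1:ℝ)/761) * n ^ ((1:ℝ) - 1/761))) :
    K ^ 831 < c ^ 831 * n ∧ K ^ 761 * n < c ^ 761 * q := by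
  subst hM
  constructor
  · have h1 : K * n < c * n ^ ((1:ℝ) + 1/831) :=
      h.trans_le (mul_le_mul_of_nonneg_left (min_le_left _ _) hc.le)
    rw [Real.rpow_add hn, Real.rpow_one] at h1
    have h2 : K < c * n ^ ((1:ℝ)/831) := by
      have : K * n < (c * n ^ ((1:ℝ)/831)) * n := by linarith
      exact lt_of_mul_lt_mul_right this hn.le
    calc K ^ 831 < (c * n ^ ((1:ℝ)/831)) ^ 831 := pow_lt_pow_left₀ h2 hK.le (by norm_num)
      _ = c ^ 831 * n := by
        rw [mul_pow, ← Real.rpow_natCast (n ^ ((1:ℝ)/831)), ← Real.rpow_mul hn.le]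
        norm_num
  · have h1 : K * n < c * (q ^ ((1:ℝ)/761) * n ^ ((1:ℝ) - 1/761)) :=
      h.trans_le (mul_le_mul_of_nonneg_left (min_le_right _ _) hc.le)
    rw [Real.rpow_sub hn, Real.rpow_one] at h1
    have hp : 0 < n ^ ((1:ℝ)/761) := by positivity
    have e : ∀ y : ℝ, 0 < y → (y ^ ((1:ℝ)/761)) ^ 761 = y := by
      intro y hy
      rw [← Real.rpow_natCast (y ^ ((1:ℝ)/761)), ← Real.rpow_mul hy.le]
      norm_num
    have h2 : K * n ^ ((1:ℝ)/761) < c * q ^ ((1:ℝ)/761) := by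
      have : (K * n ^ ((1:ℝ)/761)) * n < (c * q ^ ((1:ℝ)/761)) * n := by
        calc _ = (K * n) * n ^ ((1:ℝ)/761) := by ring
          _ < (c * (q ^ ((1:ℝ)/761) * (n / n ^ ((1:ℝ)/761)))) * n ^ ((1:ℝ)/761) := by gcongr
          _ = _ := by
            generalize n ^ ((1:ℝ)/761) = z at hp ⊢
            field_simp
      exact lt_of_mul_lt_mul_right this hn.le
    calc K ^ 761 * n = (K * n ^ ((1:ℝ)/761)) ^ 761 := by rw [mul_pow, e n hn]
      _ < (c * q ^ ((1:ℝ)/761)) ^ 761 := pow_lt_pow_left₀ h2 (by positivity) (by norm_num)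
      _ = _ := by rw [mul_pow, e q hq]

theorem stmt9 : ∀ C : ℝ, 0 < C → ∃ c' : ℝ, 0 < c' ∧
    ∀ (F : Type) [Field F] [Fintype F] (q : ℕ), IsPrimePow q → Fintype.card F = q →
    ∀ A : Finset F, 2 ≤ A.card → (0:F) ∉ A → (0:F) ∉ A + A →
    subfieldCond (A + A)⁻¹ C (((A + A).card : ℝ) ^ ((51:ℝ)/52)) →
    c' * min ((A.card : ℝ) ^ ((1:ℝ) + 1/831))
        ((q : ℝ) ^ ((1:ℝ)/761) * (A.card : ℝ) ^ ((1:ℝ) - 1/761)) ≤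
      max (((A + A).card : ℝ)) (((A⁻¹ + A⁻¹).card : ℝ)) := by
  intro C hC
  have hD1 := bigD_three hC
  have hcore := fun (F : Type) [Field F] [Fintype F] (A : Finset F) (K : ℝ) =>
    core A C K hC
  generalize bigD C = D at hD1 hcore
  have hD0 : 0 < D := lt_of_lt_of_le (by positivity) hD1
  refine ⟨D⁻¹, by positivity, ?_⟩
  intro F _ _ q _ hq A hA2 h0 hS0 hsub
  by_contra hcon
  push Not at hcon
  set M : ℝ := max (((A + A).card : ℝ)) (((A⁻¹ + A⁻¹).card : ℝ)) with hM
  set n : ℝ := (A.card : ℝ) with hn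
  have hn0 : 0 < n := by rw [hn]; exact_mod_cast (by omega : 0 < A.card)
  have hAne : A.Nonempty := Finset.card_pos.1 (by omega)
  have hMn : n ≤ M := by
    refine le_trans ?_ (le_max_left _ _)
    rw [hn]
    exact_mod_cast Finset.card_le_card_add_right hAne
  have hK : 1 ≤ M / n := by rwa [le_div_iff₀ hn0, one_mul]
  have hKM : M = M / n * n := by field_simp
  generalize M / n = K at hK hKM
  have hK0 : 0 < K := by linarith
  have hq0 : (0 : ℝ) < q := by
    rw [← hq]
    exact_mod_cast Fintype.card_pos
  obtain ⟨f1, f2⟩ := final_arith hn0 hK0 hq0 (inv_pos.2 hD0) hKM hcon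
  have hD1' : 1 ≤ D := le_trans (by norm_num) hD1
  rcases hcore F A K hK hA2 h0 hS0 (hKM ▸ le_max_left _ _) (hKM ▸ le_max_right _ _) hsub with h | h
  · rw [inv_pow, inv_mul_eq_div, lt_div_iff₀ (by positivity)] at f1
    have : D * K ^ 467 ≤ K ^ 831 * D ^ 831 := by
      rw [mul_comm]
      have a : K ^ 467 ≤ K ^ 831 := pow_le_pow_right₀ hK (by norm_num)
      have b : D ≤ D ^ 831 := le_self_pow₀ hD1' (by norm_num)
      gcongr
    exact absurd (h.trans this) (not_le.2 f1)
  · rw [hq] at h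
    rw [inv_pow, inv_mul_eq_div, lt_div_iff₀ (by positivity)] at f2
    have : 2 * 512 ^ 8 * K ^ 190 * n ≤ K ^ 761 * n * D ^ 761 := by
      have a : K ^ 190 ≤ K ^ 761 := pow_le_pow_right₀ hK (by norm_num)
      have b : D ≤ D ^ 761 := le_self_pow₀ hD1' (by norm_num)
      have c : (2 : ℝ) * 512 ^ 8 ≤ D ^ 761 := le_trans (by norm_num) (hD1.trans b)
      calc 2 * 512 ^ 8 * K ^ 190 * n ≤ D ^ 761 * K ^ 761 * n := by gcongr
        _ = _ := by ring
    exact absurd (h.trans this) (not_le.2 f2)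

end STP
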